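/- arXiv:2107.09271 — 2 statements merged into one kernel-verified Lean document; each statement's English description precedes it below -/
import Mathlib

section
/- Suppose f is locally absolutely continuous on (a,b) with α₀f := f' - (1/2)(x-a)^{-1}f ∈ L²((a,b);dx). Then for R > b - a one has ∫_a^{r₁} |f(x)|²/[(x-a)² (ln(R/(x-a)))²] dx < ∞ and lim_{x→a⁺} |f(x)|/[(x-a) ln(R/(x-a))]^{1/2} = 0, for any r₁ ∈ (a,b]. -/
open MeasureTheory Set Filter

theorem aux_deriv (a S : ℝ) (f : ℝ → ℂ) (d : ℂ) (x : ℝ) (hx : a < x)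
    (hS : 0 < S) (hL : 0 < Real.log (S / (x - a))) (hd : HasDerivAt f d x) :
    HasDerivAt (fun x => ‖f x‖ ^ 2 / ((x - a) * Real.log (S / (x - a))))
      (2 * inner ℝ (f x) (d - (((1/2) / (x - a) : ℝ) : ℂ) * f x)
          / ((x - a) * Real.log (S / (x - a)))
        + ‖f x‖ ^ 2 / ((x - a) ^ 2 * Real.log (S / (x - a)) ^ 2)) x := by
  have hu : 0 < x - a := sub_pos.2 hx
  have h1 : HasDerivAt (fun x => ‖f x‖ ^ 2) (2 * inner ℝ (f x) d) x := hd.norm_sq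
  have h2 : HasDerivAt (fun x : ℝ => x - a) 1 x := (hasDerivAt_id x).sub_const a
  have h3 : HasDerivAt (fun x : ℝ => Real.log (S / (x - a))) (-(1 / (x - a))) x := by
    have := ((hasDerivAt_const x S).div h2 hu.ne').log (div_pos hS hu).ne'
    refine this.congr_deriv ?_
    simp only [Pi.div_apply]
    field_simp
    ring
  have h4 := h1.div (h2.mul h3) (mul_pos hu hL).ne'
  refine h4.congr_deriv ?_
  have h5 : inner ℝ (f x) (d - (((1/2) / (x - a) : ℝ) : ℂ) * f x)
      = inner ℝ (f x) d - (1/2) / (x - a) * ‖f x‖ ^ 2 := by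
    rw [inner_sub_right, ← Complex.real_smul, real_inner_smul_right, real_inner_self_eq_norm_sq]
  rw [h5]
  simp only [Pi.mul_apply]
  generalize Real.log (S / (x - a)) = L at *
  field_simp
  ring

theorem aux_inner (p q : ℂ) (c : ℝ) (hc : 0 < c) :
    |2 * inner ℝ p q / c| ≤ 2 * ‖q‖ * (‖p‖ / c) := by
  rw [abs_div, abs_mul, abs_of_pos hc, abs_two]
  have := abs_real_inner_le_norm p q
  calc 2 * |inner ℝ p q| / c ≤ 2 * (‖p‖ * ‖q‖) / c := by gcongr
    _ = _ := by ring

theorem aux_logpos (a b S x : ℝ) (hS : b - a < S) (h1 : a < x) (h2 : x < b) :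
    0 < Real.log (S / (x - a)) := by
  apply Real.log_pos
  rw [lt_div_iff₀ (by linarith)]; linarith

theorem aux_cont (a b S : ℝ) (f f' : ℝ → ℂ) (hS : b - a < S)
    (hderiv : ∀ x ∈ Ioo a b, HasDerivAt f (f' x) x) :
    ContinuousOn (fun x => ‖f x‖ ^ 2 / ((x - a) ^ 2 * Real.log (S / (x - a)) ^ 2)) (Ioo a b) := by
  have hf : ContinuousOn f (Ioo a b) := fun x hx => (hderiv x hx).continuousAt.continuousWithinAt
  have hu : ContinuousOn (fun x : ℝ => x - a) (Ioo a b) := by fun_prop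
  have hl : ContinuousOn (fun x : ℝ => Real.log (S / (x - a))) (Ioo a b) := by
    apply ContinuousOn.log
    · exact continuousOn_const.div hu fun x hx => (sub_pos.2 hx.1).ne'
    · intro x hx
      have := hx.1; have := hx.2
      exact (div_pos (by linarith) (by linarith)).ne'
  refine (hf.norm.pow 2).div ((hu.pow 2).mul (hl.pow 2)) fun x hx => ?_
  have h1 := aux_logpos a b S x hS hx.1 hx.2
  have h2 := sub_pos.2 hx.1
  positivity

theorem aux_upper (a b S : ℝ) (hS : b - a < S) (f f' : ℝ → ℂ)
    (hderiv : ∀ x ∈ Ioo a b, HasDerivAt f (f' x) x)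
    (hαL2 : IntegrableOn
      (fun x => ‖f' x - (((1/2) / (x - a) : ℝ) : ℂ) * f x‖ ^ 2) (Ioo a b))
    (x y : ℝ) (hx : a < x) (hxy : x ≤ y) (hy : y < b) :
    ‖f x‖ ^ 2 / ((x - a) * Real.log (S / (x - a))) ≤
    ‖f y‖ ^ 2 / ((y - a) * Real.log (S / (y - a))) +
     ∫ t in x..y, ‖f' t - (((1/2) / (t - a) : ℝ) : ℂ) * f t‖ ^ 2 := by
  have hsub : Icc x y ⊆ Ioo a b := fun t ht => ⟨hx.trans_le ht.1, ht.2.trans_lt hy⟩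
  have hD := fun t (ht : t ∈ Icc x y) => aux_deriv a S f (f' t) t (hsub ht).1
    (by linarith) (aux_logpos a b S t hS (hsub ht).1 (hsub ht).2) (hderiv t (hsub ht))
  have := intervalIntegral.sub_le_integral_of_hasDeriv_right_of_le hxy
    (g := fun x => -(‖f x‖ ^ 2 / ((x - a) * Real.log (S / (x - a)))))
    (φ := fun t => ‖f' t - (((1/2) / (t - a) : ℝ) : ℂ) * f t‖ ^ 2)
    (fun t ht => (hD t ht).neg.continuousAt.continuousWithinAt)
    (fun t ht => (hD t (Ioo_subset_Icc_self ht)).neg.hasDerivWithinAt)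
    (hαL2.mono_set hsub) (fun t ht => by
      have ht' := hsub (Ioo_subset_Icc_self ht)
      have hL := aux_logpos a b S t hS ht'.1 ht'.2
      have hu := sub_pos.2 ht'.1
      have h1 := (abs_le.1 (aux_inner (f t) (f' t - (((1/2) / (t - a) : ℝ) : ℂ) * f t) _
        (mul_pos hu hL))).1
      have h2 := sq_nonneg (‖f' t - (((1/2) / (t - a) : ℝ) : ℂ) * f t‖
        - ‖f t‖ / ((t - a) * Real.log (S / (t - a))))
      have h3 : ‖f t‖ ^ 2 / ((t - a) ^ 2 * Real.log (S / (t - a)) ^ 2)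
        = (‖f t‖ / ((t - a) * Real.log (S / (t - a)))) ^ 2 := by rw [div_pow, mul_pow]
      rw [h3]
      linarith)
  linarith

theorem aux_lower (a b S : ℝ) (hS : b - a < S) (f f' : ℝ → ℂ)
    (hderiv : ∀ x ∈ Ioo a b, HasDerivAt f (f' x) x)
    (hαL2 : IntegrableOn
      (fun x => ‖f' x - (((1/2) / (x - a) : ℝ) : ℂ) * f x‖ ^ 2) (Ioo a b))
    (x y : ℝ) (hx : a < x) (hxy : x ≤ y) (hy : y < b) :
    ∫ t in x..y, ‖f t‖ ^ 2 / ((t - a) ^ 2 * Real.log (S / (t - a)) ^ 2) ≤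
    2 * (‖f y‖ ^ 2 / ((y - a) * Real.log (S / (y - a)))) +
     4 * ∫ t in x..y, ‖f' t - (((1/2) / (t - a) : ℝ) : ℂ) * f t‖ ^ 2 := by
  have hsub : Icc x y ⊆ Ioo a b := fun t ht => ⟨hx.trans_le ht.1, ht.2.trans_lt hy⟩
  have hD := fun t (ht : t ∈ Icc x y) => aux_deriv a S f (f' t) t (hsub ht).1
    (by linarith) (aux_logpos a b S t hS (hsub ht).1 (hsub ht).2) (hderiv t (hsub ht))
  have hw : IntegrableOn (fun x => ‖f x‖ ^ 2 / ((x - a) ^ 2 * Real.log (S / (x - a)) ^ 2))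
    (Icc x y) := ((aux_cont a b S f f' hS hderiv).mono hsub).integrableOn_Icc
  have hH := hαL2.mono_set hsub
  have := intervalIntegral.integral_le_sub_of_hasDeriv_right_of_le hxy
    (g := fun x => (‖f x‖ ^ 2 / ((x - a) * Real.log (S / (x - a)))))
    (φ := fun t => (1/2) * (‖f t‖ ^ 2 / ((t - a) ^ 2 * Real.log (S / (t - a)) ^ 2))
      - 2 * ‖f' t - (((1/2) / (t - a) : ℝ) : ℂ) * f t‖ ^ 2)
    (fun t ht => (hD t ht).continuousAt.continuousWithinAt)
    (fun t ht => (hD t (Ioo_subset_Icc_self ht)).hasDerivWithinAt)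
    (Integrable.sub (hw.const_mul (1/2)) (hH.const_mul 2)) (fun t ht => by
      have ht' := hsub (Ioo_subset_Icc_self ht)
      have hL := aux_logpos a b S t hS ht'.1 ht'.2
      have hu := sub_pos.2 ht'.1
      have h1 := (abs_le.1 (aux_inner (f t) (f' t - (((1/2) / (t - a) : ℝ) : ℂ) * f t) _
        (mul_pos hu hL))).1
      have h2 := sq_nonneg (2 * ‖f' t - (((1/2) / (t - a) : ℝ) : ℂ) * f t‖
        - ‖f t‖ / ((t - a) * Real.log (S / (t - a))))
      have h3 : ‖f t‖ ^ 2 / ((t - a) ^ 2 * Real.log (S / (t - a)) ^ 2)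
        = (‖f t‖ / ((t - a) * Real.log (S / (t - a)))) ^ 2 := by rw [div_pow, mul_pow]
      rw [h3]
      linarith)
  have i1 := (intervalIntegrable_iff_integrableOn_Icc_of_le hxy).2 hw
  have i2 := (intervalIntegrable_iff_integrableOn_Icc_of_le hxy).2 hH
  rw [intervalIntegral.integral_sub (i1.const_mul _) (i2.const_mul _),
    intervalIntegral.integral_const_mul, intervalIntegral.integral_const_mul] at this
  have h0 : 0 ≤ ‖f x‖ ^ 2 / ((x - a) * Real.log (S / (x - a))) := by
    have := aux_logpos a b S x hS hx (hxy.trans_lt hy)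
    have := sub_pos.2 hx
    positivity
  linarith

theorem aux_int_le (a b : ℝ) (H : ℝ → ℝ) (h0 : ∀ t, 0 ≤ H t) (hH : IntegrableOn H (Ioo a b))
    (x y z : ℝ) (hx : a < x) (hxy : x ≤ y) (hyz : y ≤ z) (hz : z ≤ b) :
    ∫ t in x..y, H t ≤ ∫ t in Ioc a z, H t := by
  rw [intervalIntegral.integral_of_le hxy]
  refine setIntegral_mono_set ?_ (ae_of_all _ h0)
    (HasSubset.Subset.eventuallyLE fun t ht => ⟨hx.trans ht.1, ht.2.trans hyz⟩)
  exact ((integrableOn_Icc_iff_integrableOn_Ioo (by simp) (by simp)).2 hH).mono_set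
    fun t ht => ⟨ht.1.le, ht.2.trans hz⟩

/-- `f` is bounded near `b`. -/
theorem aux_bdd (a b c : ℝ) (hac : a < c) (hcb : c < b) (f f' : ℝ → ℂ)
    (hderiv : ∀ x ∈ Ioo a b, HasDerivAt f (f' x) x)
    (hαL2 : IntegrableOn
      (fun x => ‖f' x - (((1/2) / (x - a) : ℝ) : ℂ) * f x‖ ^ 2) (Ioo a b)) :
    ∃ K, ∀ y, c ≤ y → y < b → ‖f y‖ ^ 2 ≤ K := by
  set H := fun x => ‖f' x - (((1/2) / (x - a) : ℝ) : ℂ) * f x‖ ^ 2 with hHdef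
  refine ⟨Real.exp (Real.log (1 + ‖f c‖ ^ 2) + (∫ t in Ioc a b, H t)
    + (b - c) * (1 + 1 / (c - a))), fun y hcy hyb => ?_⟩
  have hca : 0 < c - a := sub_pos.2 hac
  have hsub : Icc c y ⊆ Ioo a b := fun t ht => ⟨hac.trans_le ht.1, ht.2.trans_lt hyb⟩
  have hD : ∀ t ∈ Icc c y, HasDerivAt (fun t => Real.log (1 + ‖f t‖ ^ 2))
      (2 * inner ℝ (f t) (f' t) / (1 + ‖f t‖ ^ 2)) t := fun t ht =>
    ((hderiv t (hsub ht)).norm_sq.const_add 1).log (by positivity)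
  have hH := hαL2.mono_set hsub
  have := intervalIntegral.sub_le_integral_of_hasDeriv_right_of_le hcy
    (g := fun t => Real.log (1 + ‖f t‖ ^ 2))
    (φ := fun t => H t + (1 + 1 / (c - a)))
    (fun t ht => (hD t ht).continuousAt.continuousWithinAt)
    (fun t ht => (hD t (Ioo_subset_Icc_self ht)).hasDerivWithinAt)
    (hH.add continuousOn_const.integrableOn_Icc) (fun t ht => by
      have ht' := hsub (Ioo_subset_Icc_self ht)
      have hu := sub_pos.2 ht'.1
      have h5 : inner ℝ (f t) (f' t - (((1/2) / (t - a) : ℝ) : ℂ) * f t)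
          = inner ℝ (f t) (f' t) - (1/2) / (t - a) * ‖f t‖ ^ 2 := by
        rw [inner_sub_right, ← Complex.real_smul, real_inner_smul_right,
          real_inner_self_eq_norm_sq]
      have h6 := real_inner_le_norm (f t) (f' t - (((1/2) / (t - a) : ℝ) : ℂ) * f t)
      have h7 := sq_nonneg (‖f t‖ - ‖f' t - (((1/2) / (t - a) : ℝ) : ℂ) * f t‖)
      have h8 : 1 / (t - a) ≤ 1 / (c - a) :=
        one_div_le_one_div_of_le hca (by linarith [ht.1])
      have h9 : 1 / (t - a) * ‖f t‖ ^ 2 ≤ 1 / (c - a) * ‖f t‖ ^ 2 := by gcongr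
      have h10 : (1/2) / (t - a) * ‖f t‖ ^ 2 = (1/2) * (1 / (t - a) * ‖f t‖ ^ 2) := by ring
      have hHt : H t = ‖f' t - (((1/2) / (t - a) : ℝ) : ℂ) * f t‖ ^ 2 := rfl
      have h11 : 0 ≤ H t * ‖f t‖ ^ 2 := by rw [hHt]; positivity
      have h12 : 0 < 1 / (c - a) := by positivity
      rw [div_le_iff₀ (by positivity)]
      nlinarith)
  have i2 := (intervalIntegrable_iff_integrableOn_Icc_of_le hcy).2 hH
  rw [intervalIntegral.integral_add i2 (by simp), intervalIntegral.integral_const,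
    smul_eq_mul] at this
  have h1 := aux_int_le a b H (fun t => by positivity) hαL2 c y b hac hcy hyb.le le_rfl
  have h12 : 0 < 1 / (c - a) := by positivity
  have h2 : (y - c) * (1 + 1 / (c - a)) ≤ (b - c) * (1 + 1 / (c - a)) := by gcongr
  have h3 : Real.log (1 + ‖f y‖ ^ 2) ≤ Real.log (1 + ‖f c‖ ^ 2) + (∫ t in Ioc a b, H t)
    + (b - c) * (1 + 1 / (c - a)) := by linarith
  rw [Real.log_le_iff_le_exp (by positivity)] at h3
  linarith

theorem aux_integrable (a b R : ℝ) (hab : a < b) (hR : b - a < R)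
    (f f' : ℝ → ℂ)
    (hderiv : ∀ x ∈ Ioo a b, HasDerivAt f (f' x) x)
    (hαL2 : IntegrableOn
      (fun x => ‖f' x - (((1/2) / (x - a) : ℝ) : ℂ) * f x‖ ^ 2) (Ioo a b)) :
    IntegrableOn (fun x => ‖f x‖ ^ 2 / ((x - a) ^ 2 * Real.log (R / (x - a)) ^ 2))
        (Ioo a b) := by
  obtain ⟨c, hac, hcb⟩ := exists_between hab
  obtain ⟨K, hK⟩ := aux_bdd a b c hac hcb f f' hderiv hαL2
  set H := fun x => ‖f' x - (((1/2) / (x - a) : ℝ) : ℂ) * f x‖ ^ 2 with hHdef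
  obtain ⟨u, -, hu1, hu2⟩ := exists_seq_strictAnti_tendsto' hac
  obtain ⟨v, -, hv1, hv2⟩ := exists_seq_strictMono_tendsto' hcb
  have hl0 : 0 < Real.log (R / (b - a)) :=
    Real.log_pos (by rw [lt_div_iff₀ (by linarith)]; linarith)
  have hca : 0 < c - a := sub_pos.2 hac
  rw [← integrableOn_Ioc_iff_integrableOn_Ioo]
  refine integrableOn_Ioc_of_intervalIntegral_norm_bounded (l := atTop) (a := u) (b := v)
    (I := 2 * (K / ((c - a) * Real.log (R / (b - a)))) + 4 * ∫ t in Ioc a b, H t)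
    (fun n => ?_) hu2 hv2 (Eventually.of_forall fun n => ?_)
  · refine (((aux_cont a b R f f' hR hderiv).mono fun t ht =>
      ⟨(hu1 n).1.trans_le ht.1, ht.2.trans_lt (hv1 n).2⟩).integrableOn_Icc).mono_set
      Ioc_subset_Icc_self
  · have huv : u n ≤ v n := (hu1 n).2.le.trans (hv1 n).1.le
    have e : ∀ x, ‖‖f x‖ ^ 2 / ((x - a) ^ 2 * Real.log (R / (x - a)) ^ 2)‖
        = ‖f x‖ ^ 2 / ((x - a) ^ 2 * Real.log (R / (x - a)) ^ 2) := fun x =>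
      Real.norm_of_nonneg (by positivity)
    simp only [e]
    rw [← intervalIntegral.integral_of_le huv] 
    refine (aux_lower a b R hR f f' hderiv hαL2 (u n) (v n) (hu1 n).1 huv (hv1 n).2).trans ?_
    have h1 := aux_int_le a b H (fun t => by positivity) hαL2 (u n) (v n) b (hu1 n).1 huv
      (hv1 n).2.le le_rfl
    have h2 := hK (v n) (hv1 n).1.le (hv1 n).2
    have hva : c - a ≤ v n - a := by linarith [(hv1 n).1]
    have hvb : v n - a ≤ b - a := by linarith [(hv1 n).2]
    have hva0 : 0 < v n - a := by linarith
    have h3 : Real.log (R / (b - a)) ≤ Real.log (R / (v n - a)) := by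
      apply Real.log_le_log (div_pos (by linarith) (by linarith))
      exact div_le_div_of_nonneg_left (by linarith) hva0 hvb
    have h4 : ‖f (v n)‖ ^ 2 / ((v n - a) * Real.log (R / (v n - a))) ≤
      K / ((c - a) * Real.log (R / (b - a))) := by
      have : 0 ≤ K := le_trans (by positivity) h2
      gcongr
    linarith

theorem aux_tendsto (a b R : ℝ) (hab : a < b) (hR : b - a < R)
    (f f' : ℝ → ℂ)
    (hderiv : ∀ x ∈ Ioo a b, HasDerivAt f (f' x) x)
    (hαL2 : IntegrableOn
      (fun x => ‖f' x - (((1/2) / (x - a) : ℝ) : ℂ) * f x‖ ^ 2) (Ioo a b)) :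
    Tendsto (fun x => ‖f x‖ ^ 2 / ((x - a) * Real.log (R / (x - a))))
        (nhdsWithin a (Ioi a)) (nhds 0) := by
  set H := fun x => ‖f' x - (((1/2) / (x - a) : ℝ) : ℂ) * f x‖ ^ 2 with hHdef
  have hR0 : 0 < R := by linarith
  have hIoo : ∀ᶠ x in nhdsWithin a (Ioi a), x ∈ Ioo a b := Ioo_mem_nhdsGT hab
  have hprim : Tendsto (fun y => ∫ t in Ioc a y, H t) (nhdsWithin a (Ioi a)) (nhds 0) := by
    have hc := intervalIntegral.continuousOn_primitive
      ((integrableOn_Icc_iff_integrableOn_Ioo (by simp) (by simp)).2 hαL2) a (left_mem_Icc.2 hab.le)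
    have h0 : ∫ t in Ioc a a, H t = 0 := by simp
    have := hc.tendsto
    rw [h0] at this
    exact this.mono_left (nhdsWithin_le_iff.2 (mem_of_superset hIoo Ioo_subset_Icc_self))
  have hlog : Tendsto (fun x => Real.log (R / (x - a))) (nhdsWithin a (Ioi a)) atTop := by
    apply Real.tendsto_log_atTop.comp
    have h1 : Tendsto (fun x : ℝ => x - a) (nhdsWithin a (Ioi a)) (nhdsWithin 0 (Ioi 0)) := by
      apply tendsto_nhdsWithin_iff.2 ⟨?_, ?_⟩
      · have : Tendsto (fun x : ℝ => x - a) (nhds a) (nhds (a - a)) :=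
          (continuous_id.sub continuous_const).tendsto a
        rw [sub_self] at this
        exact this.mono_left nhdsWithin_le_nhds
      · filter_upwards [self_mem_nhdsWithin] with x hx
        exact sub_pos.2 (mem_Ioi.1 hx)
    simpa only [div_eq_mul_inv, Pi.inv_apply] using h1.inv_tendsto_nhdsGT_zero.const_mul_atTop hR0
  rw [Metric.tendsto_nhds]
  intro ε hε
  obtain ⟨y, hyI, hy⟩ := ((hprim.eventually (gt_mem_nhds (by positivity : (0:ℝ) < ε / 4))).and
    hIoo).exists
  have hya : 0 < y - a := sub_pos.2 hy.1
  -- the shift of the logarithm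
  have hM : Tendsto (fun M : ℝ => ‖f y‖ ^ 2 / ((y - a) * (M + Real.log (R / (y - a)))))
      atTop (nhds 0) :=
    tendsto_const_nhds.div_atTop
      ((tendsto_atTop_add_const_right _ _ tendsto_id).const_mul_atTop hya)
  obtain ⟨M, hMy, hM0⟩ := ((hM.eventually (gt_mem_nhds (by positivity : (0:ℝ) < ε / 4))).and
    (eventually_ge_atTop 0)).exists
  have hlogS : ∀ x, a < x → Real.log (Real.exp M * R / (x - a)) = M + Real.log (R / (x - a)) := by
    intro x hx
    have := sub_pos.2 hx
    rw [mul_div_assoc, Real.log_mul (Real.exp_pos M).ne' (by positivity), Real.log_exp]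
  have hS : b - a < Real.exp M * R := by
    have := Real.one_le_exp hM0
    nlinarith
  filter_upwards [Ioo_mem_nhdsGT hy.1, hlog.eventually_ge_atTop M] with x hx hxM
  have hxb : x < b := hx.2.trans hy.2
  have hL := aux_logpos a b R x hR hx.1 hxb
  have hxa := sub_pos.2 hx.1
  have h1 := aux_upper a b _ hS f f' hderiv hαL2 x y hx.1 hx.2.le hy.2
  rw [hlogS x hx.1, hlogS y hy.1] at h1
  have h2 := aux_int_le a b H (fun t => by positivity) hαL2 x y y hx.1 hx.2.le le_rfl hy.2.le
  have h3 : ‖f x‖ ^ 2 / ((x - a) * Real.log (R / (x - a))) ≤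
      2 * (‖f x‖ ^ 2 / ((x - a) * (M + Real.log (R / (x - a))))) := by
    rw [← mul_div_assoc, div_le_div_iff₀ (by positivity) (by positivity)]
    have : (x - a) * (M + Real.log (R / (x - a))) ≤ 2 * ((x - a) * Real.log (R / (x - a))) := by
      nlinarith
    nlinarith [mul_le_mul_of_nonneg_left this (sq_nonneg ‖f x‖)]
  rw [Real.dist_eq, sub_zero, abs_of_nonneg (by positivity)]
  linarith

/-- For `f` locally absolutely continuous on `(a,b)` with
`α₀ f = f' - (1/2)(x-a)⁻¹ f ∈ L²((a,b))` and `R > b - a`: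
`|f|²/[(x-a)² (ln(R/(x-a)))²] ∈ L¹((a,r₁))` and
`|f(x)|/[(x-a) ln(R/(x-a))]^{1/2} → 0` as `x → a⁺`, for any `r₁ ∈ (a,b]`. -/
theorem stmt10 (a b R : ℝ) (hab : a < b) (hR : b - a < R)
    (f f' : ℝ → ℂ)
    (hderiv : ∀ x ∈ Ioo a b, HasDerivAt f (f' x) x)
    (hαL2 : IntegrableOn
      (fun x => ‖f' x - (((1/2) / (x - a) : ℝ) : ℂ) * f x‖ ^ 2) (Ioo a b)) :
    ∀ r₁, a < r₁ → r₁ ≤ b →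
      IntegrableOn
        (fun x => ‖f x‖ ^ 2 / ((x - a) ^ 2 * Real.log (R / (x - a)) ^ 2))
        (Ioo a r₁) ∧
      Tendsto (fun x => ‖f x‖ / ((x - a) * Real.log (R / (x - a))) ^ ((1 : ℝ)/2))
        (nhdsWithin a (Ioi a)) (nhds 0) := by
  intro r₁ har hrb
  refine ⟨(aux_integrable a b R hab hR f f' hderiv hαL2).mono_set
    (Ioo_subset_Ioo_right hrb), ?_⟩
  have h := (aux_tendsto a b R hab hR f f' hderiv hαL2).sqrt
  rw [Real.sqrt_zero] at h
  refine h.congr fun x => ?_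
  rw [Real.sqrt_div (by positivity), Real.sqrt_sq (norm_nonneg _), Real.sqrt_eq_rpow]
end

section
/- (Muckenhoupt's two-weight Hardy inequality, p=2 case) Let u, v ≥ 0 be measurable on (a,b). The inequality ∫_a^b u(x)(∫_a^x f(t) dt)² dx ≤ C² ∫_a^b v(x) f(x)² dx holds for all measurable f ≥ 0 with some finite constant C if and only if A := sup_{c∈(a,b)} (∫_c^b u(s) ds)^{1/2} (∫_a^c v(t)^{-1} dt)^{1/2} < ∞; moreover the best constant C satisfies A ≤ C ≤ 2A. -/
open MeasureTheory Set Filter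

lemma hh_Iic (μ : Measure ℝ) (s : ENNReal) : μ {t | μ (Iic t) ≤ s} ≤ s := by
  by_cases h : ∃ m, μ (Iic m) ≤ s ∧ ∀ t, μ (Iic t) ≤ s → t ≤ m
  · obtain ⟨m, hm, hm'⟩ := h
    exact (measure_mono (fun t ht => hm' t ht)).trans hm
  · push Not at h
    have hsub : {t | μ (Iic t) ≤ s} ⊆ ⋃ q ∈ {q : ℚ | μ (Iic (q : ℝ)) ≤ s}, Iic (q : ℝ) := by
      intro t ht
      obtain ⟨t', ht', hlt⟩ := h t ht
      obtain ⟨q, hq1, hq2⟩ := exists_rat_btwn hlt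
      simp only [mem_iUnion, mem_ofPred_eq, mem_Iic]
      exact ⟨q, (measure_mono (Iic_subset_Iic.2 hq2.le)).trans ht', hq1.le⟩
    refine (measure_mono hsub).trans ?_
    rw [measure_biUnion_eq_iSup (to_countable _)]
    · exact iSup₂_le fun q hq => hq
    · intro p hp q hq
      rcases le_total p q with hpq | hpq
      · exact ⟨q, hq, Iic_subset_Iic.2 (by exact_mod_cast hpq), subset_rfl⟩
      · exact ⟨p, hp, subset_rfl, Iic_subset_Iic.2 (by exact_mod_cast hpq)⟩

lemma hh_Ici (μ : Measure ℝ) (s : ENNReal) : μ {t | μ (Ici t) ≤ s} ≤ s := by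
  by_cases h : ∃ m, μ (Ici m) ≤ s ∧ ∀ t, μ (Ici t) ≤ s → m ≤ t
  · obtain ⟨m, hm, hm'⟩ := h
    exact (measure_mono (fun t ht => hm' t ht)).trans hm
  · push Not at h
    have hsub : {t | μ (Ici t) ≤ s} ⊆ ⋃ q ∈ {q : ℚ | μ (Ici (q : ℝ)) ≤ s}, Ici (q : ℝ) := by
      intro t ht
      obtain ⟨t', ht', hlt⟩ := h t ht
      obtain ⟨q, hq1, hq2⟩ := exists_rat_btwn hlt
      simp only [mem_iUnion, mem_ofPred_eq, mem_Ici]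
      exact ⟨q, (measure_mono (Ici_subset_Ici.2 hq1.le)).trans ht', hq2.le⟩
    refine (measure_mono hsub).trans ?_
    rw [measure_biUnion_eq_iSup (to_countable _)]
    · exact iSup₂_le fun q hq => hq
    · intro p hp q hq
      rcases le_total p q with hpq | hpq
      · exact ⟨p, hp, subset_rfl, Ici_subset_Ici.2 (by exact_mod_cast hpq)⟩
      · exact ⟨q, hq, Ici_subset_Ici.2 (by exact_mod_cast hpq), subset_rfl⟩

lemma hh_int (m : ℝ) (hm : 0 < m) :
    ∫⁻ r in Ioi (0:ℝ), min (ENNReal.ofReal m) (ENNReal.ofReal (r ^ (-2:ℝ)))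
      ≤ 2 * ENNReal.ofReal m ^ ((1:ℝ)/2) := by
  set k := m ^ (-(1/2) : ℝ) with hk
  have hk0 : 0 < k := Real.rpow_pos_of_pos hm _
  rw [← Ioc_union_Ioi_eq_Ioi hk0.le]
  refine (lintegral_union_le _ _ _).trans ?_
  have h1 : ∫⁻ r in Ioc 0 k, min (ENNReal.ofReal m) (ENNReal.ofReal (r ^ (-2:ℝ)))
      ≤ ENNReal.ofReal m ^ ((1:ℝ)/2) := by
    refine (lintegral_mono (fun r => min_le_left _ _)).trans ?_
    rw [setLIntegral_const, Real.volume_Ioc, ← ENNReal.ofReal_mul hm.le,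
      ENNReal.ofReal_rpow_of_pos hm]
    apply ENNReal.ofReal_le_ofReal
    rw [sub_zero, hk]
    nth_rewrite 1 [← Real.rpow_one m]
    rw [← Real.rpow_add hm]; norm_num
  have h2 : ∫⁻ r in Ioi k, min (ENNReal.ofReal m) (ENNReal.ofReal (r ^ (-2:ℝ)))
      ≤ ENNReal.ofReal m ^ ((1:ℝ)/2) := by
    refine (lintegral_mono (fun r => min_le_right _ _)).trans ?_
    rw [← ofReal_integral_eq_lintegral_ofReal
      (integrableOn_Ioi_rpow_of_lt (by norm_num) hk0)]
    · rw [integral_Ioi_rpow_of_lt (by norm_num) hk0, ENNReal.ofReal_rpow_of_pos hm]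
      apply ENNReal.ofReal_le_ofReal
      rw [hk, ← Real.rpow_mul hm.le]; norm_num
    · filter_upwards [ae_restrict_mem measurableSet_Ioi] with r hr
      exact Real.rpow_nonneg (hk0.trans hr).le _
  rw [two_mul]
  exact add_le_add h1 h2

lemma hh_layer (μ : Measure ℝ) (F : ℝ → ENNReal) (hFm : Measurable F)
    (hF : ∀ s, μ {t | F t ≤ s} ≤ s) :
    ∫⁻ t, F t ^ (-(1/2) : ℝ) ∂μ ≤ 2 * μ univ ^ ((1:ℝ)/2) := by
  rcases eq_or_ne (μ univ) ⊤ with htop | htop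
  · rw [htop, ENNReal.top_rpow_of_pos (by norm_num)]; simp
  rcases eq_or_ne (μ univ) 0 with h0 | h0
  · rw [Measure.measure_univ_eq_zero] at h0; simp [h0]
  have hm : 0 < (μ univ).toReal := ENNReal.toReal_pos h0 htop
  have key := hh_int _ hm
  rw [ENNReal.ofReal_toReal htop] at key
  have hne : ∀ᵐ t ∂μ, F t ≠ 0 := by
    rw [ae_iff]; simp only [ne_eq, not_not]
    have := hF 0
    simpa using this
  have hcongr : ∫⁻ t, F t ^ (-(1/2) : ℝ) ∂μ
      = ∫⁻ t, ENNReal.ofReal ((F t ^ (-(1/2) : ℝ)).toReal) ∂μ := by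
    apply lintegral_congr_ae
    filter_upwards [hne] with t ht
    rw [ENNReal.ofReal_toReal]
    intro h
    rw [ENNReal.rpow_eq_top_iff] at h
    rcases h with h | h
    · exact ht h.1
    · linarith [h.2]
  rw [hcongr, lintegral_eq_lintegral_meas_lt μ (Eventually.of_forall fun t => ENNReal.toReal_nonneg)
    ((hFm.pow_const _).ennreal_toReal.aemeasurable)]
  refine le_trans ?_ key
  refine lintegral_mono_ae ?_
  filter_upwards [ae_restrict_mem measurableSet_Ioi] with r hr
  have hr : (0:ℝ) < r := hr
  refine le_min (measure_mono (subset_univ _)) ?_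
  refine le_trans (measure_mono ?_) (hF _)
  intro t ht
  simp only [mem_ofPred_eq] at ht ⊢
  have h1 : ENNReal.ofReal r ≤ F t ^ (-(1/2) : ℝ) :=
    (ENNReal.ofReal_le_ofReal ht.le).trans ENNReal.ofReal_toReal_le
  rw [← ENNReal.ofReal_rpow_of_pos hr]
  have h2 := ENNReal.rpow_le_rpow h1 (show (0:ℝ) ≤ 2 by norm_num)
  rw [← ENNReal.rpow_mul] at h2
  norm_num at h2
  rw [ENNReal.rpow_neg_one] at h2
  rw [ENNReal.rpow_neg, ENNReal.le_inv_iff_le_inv]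
  simpa using h2

lemma hh_cs (μ : Measure ℝ) (f g : ℝ → ENNReal) (hf : Measurable f) (hg : Measurable g) :
    (∫⁻ t, f t * g t ∂μ) ^ 2 ≤ (∫⁻ t, f t ^ 2 ∂μ) * (∫⁻ t, g t ^ 2 ∂μ) := by
  have h := ENNReal.lintegral_mul_le_Lp_mul_Lq μ Real.HolderConjugate.two_two hf.aemeasurable hg.aemeasurable
  have h2 := pow_le_pow_left' h 2
  refine h2.trans (le_of_eq ?_)
  rw [mul_pow]
  simp only [ENNReal.rpow_two]
  rw [← ENNReal.rpow_natCast, ← ENNReal.rpow_natCast, ← ENNReal.rpow_mul, ← ENNReal.rpow_mul]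
  norm_num

lemma hh_V (W : ℝ → ENNReal) (hW : Measurable W) (a x : ℝ) :
    ∫⁻ t in Ioo a x, W t * (∫⁻ r in Ioo a t, W r) ^ (-(1/2) : ℝ)
      ≤ 2 * (∫⁻ t in Ioo a x, W t) ^ ((1:ℝ)/2) := by
  set μ := (volume.restrict (Ioo a x)).withDensity W with hμ
  have hmono : Monotone fun t => μ (Iic t) := fun s t h => measure_mono (Iic_subset_Iic.2 h)
  have h := hh_layer μ (fun t => μ (Iic t)) hmono.measurable (hh_Iic μ)
  have hu : μ univ = ∫⁻ t in Ioo a x, W t := by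
    rw [hμ, withDensity_apply _ MeasurableSet.univ, Measure.restrict_univ]
  rw [hu] at h
  refine le_trans (le_of_eq ?_) h
  rw [hμ, lintegral_withDensity_eq_lintegral_mul _ hW (hmono.measurable.pow_const _)]
  apply setLIntegral_congr_fun measurableSet_Ioo
  intro t ht
  simp only [Pi.mul_apply]
  congr 2
  rw [withDensity_apply _ measurableSet_Iic, Measure.restrict_restrict measurableSet_Iic]
  have : Iic t ∩ Ioo a x = Ioc a t := by
    ext s; simp only [mem_inter_iff, mem_Iic, mem_Ioo, mem_Ioc]
    exact ⟨fun h => ⟨h.2.1, h.1⟩, fun h => ⟨h.2, h.1, h.2.trans_lt ht.2⟩⟩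
  rw [this]
  exact setLIntegral_congr Ioo_ae_eq_Ioc

lemma hh_U (u : ℝ → ENNReal) (hu : Measurable u) (I : Set ℝ) (hI : MeasurableSet I) (t : ℝ) :
    ∫⁻ x in I ∩ Ioi t, u x * (∫⁻ r in I ∩ Ioi x, u r) ^ (-(1/2) : ℝ)
      ≤ 2 * (∫⁻ x in I ∩ Ioi t, u x) ^ ((1:ℝ)/2) := by
  set μ := (volume.restrict (I ∩ Ioi t)).withDensity u with hμ
  have hmono : Antitone fun t => μ (Ici t) := fun s t h => measure_mono (Ici_subset_Ici.2 h)
  have h := hh_layer μ (fun t => μ (Ici t)) hmono.measurable (hh_Ici μ)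
  have hu' : μ univ = ∫⁻ x in I ∩ Ioi t, u x := by
    rw [hμ, withDensity_apply _ MeasurableSet.univ, Measure.restrict_univ]
  rw [hu'] at h
  refine le_trans (le_of_eq ?_) h
  rw [hμ, lintegral_withDensity_eq_lintegral_mul _ hu (hmono.measurable.pow_const _)]
  apply setLIntegral_congr_fun (hI.inter measurableSet_Ioi)
  intro x hx
  simp only [Pi.mul_apply]
  congr 2
  rw [withDensity_apply _ measurableSet_Ici, Measure.restrict_restrict measurableSet_Ici]
  have : Ici x ∩ (I ∩ Ioi t) = I ∩ Ici x := by
    ext s; simp only [mem_inter_iff, mem_Ici, mem_Ioi]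
    exact ⟨fun h => ⟨h.2.1, h.1⟩, fun h => ⟨h.2, h.1, lt_of_lt_of_le hx.2 h.2⟩⟩
  rw [this]
  exact setLIntegral_congr ((ae_eq_refl I).inter Ioi_ae_eq_Ici)

lemma hh_U0 (u : ℝ → ENNReal) (hu : Measurable u) (I : Set ℝ) :
    ∀ᵐ x ∂(volume.restrict I), u x ≠ 0 → ∫⁻ r in I ∩ Ioi x, u r ≠ 0 := by
  set μ := (volume.restrict I).withDensity u with hμ
  rw [← ae_withDensity_iff hu, ← hμ, ae_iff]
  refine le_antisymm (le_trans (measure_mono ?_) (hh_Ici μ 0)) bot_le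
  intro x hx
  simp only [mem_ofPred_eq, not_not, ne_eq] at hx ⊢
  rw [hμ, withDensity_apply _ measurableSet_Ici, Measure.restrict_restrict measurableSet_Ici,
    inter_comm, ← hx]
  exact le_of_eq (setLIntegral_congr ((ae_eq_refl I).inter Ioi_ae_eq_Ici)).symm

lemma hh_Vpos (w : ℝ → ENNReal) (hw : Measurable w) (hwt : ∀ x, w x ≠ ⊤) (a c : ℝ) (hc : a < c) :
    ∫⁻ t in Ioo a c, (w t)⁻¹ ≠ 0 := by
  intro h
  rw [lintegral_eq_zero_iff (f := fun t => (w t)⁻¹) hw.inv] at h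
  have : ∀ᵐ x ∂(volume.restrict (Ioo a c)), False := by
    filter_upwards [h] with x hx
    simp at hx
    exact hwt x hx
  have hz := ae_iff.1 this
  simp at hz
  linarith

lemma hh_step (w f : ℝ → ENNReal) (hw : Measurable w) (hwt : ∀ x, w x ≠ ⊤) (hf : Measurable f)
    (a x : ℝ) (hV : ∫⁻ t in Ioo a x, (w t)⁻¹ ≠ ⊤) :
    (∫⁻ t in Ioo a x, f t) ^ 2 ≤
      (∫⁻ t in Ioo a x, w t * f t ^ 2 * (∫⁻ r in Ioo a t, (w r)⁻¹) ^ ((1:ℝ)/2)) *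
      (2 * (∫⁻ t in Ioo a x, (w t)⁻¹) ^ ((1:ℝ)/2)) := by
  set V : ℝ → ENNReal := fun t => ∫⁻ r in Ioo a t, (w r)⁻¹ with hVdef
  have hVmono : Monotone V := fun s t h => lintegral_mono_set (Ioo_subset_Ioo_right h)
  have hVm := hVmono.measurable
  have hw0 : ∀ᵐ t ∂(volume.restrict (Ioo a x)), w t ≠ 0 := by
    filter_upwards [ae_lt_top hw.inv hV] with t ht h0
    simp [h0] at ht
  have h1 := hh_cs (volume.restrict (Ioo a x))
    (fun t => f t * (w t) ^ ((1:ℝ)/2) * V t ^ ((1:ℝ)/4))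
    (fun t => ((w t)⁻¹) ^ ((1:ℝ)/2) * (V t) ^ (-(1/4):ℝ))
    ((hf.mul (hw.pow_const _)).mul (hVm.pow_const _))
    ((hw.inv.pow_const _).mul (hVm.pow_const _))
  have e0 : ∫⁻ t in Ioo a x, f t = ∫⁻ t in Ioo a x, (f t * (w t) ^ ((1:ℝ)/2) * V t ^ ((1:ℝ)/4)) *
      (((w t)⁻¹) ^ ((1:ℝ)/2) * (V t) ^ (-(1/4):ℝ)) := by
    apply lintegral_congr_ae
    filter_upwards [hw0, ae_restrict_mem measurableSet_Ioo] with t ht htx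
    have hV0 : V t ≠ 0 := hh_Vpos w hw hwt a t htx.1
    have hVt : V t ≠ ⊤ := ne_top_of_le_ne_top hV (hVmono htx.2.le)
    have a1 : (w t) ^ ((1:ℝ)/2) * ((w t)⁻¹) ^ ((1:ℝ)/2) = 1 := by
      rw [← ENNReal.mul_rpow_of_nonneg _ _ (by norm_num), ENNReal.mul_inv_cancel ht (hwt t)]
      simp
    have a2 : V t ^ ((1:ℝ)/4) * (V t) ^ (-(1/4):ℝ) = 1 := by
      rw [← ENNReal.rpow_add _ _ hV0 hVt]; norm_num
    calc f t = f t * ((w t) ^ ((1:ℝ)/2) * ((w t)⁻¹) ^ ((1:ℝ)/2)) *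
          (V t ^ ((1:ℝ)/4) * (V t) ^ (-(1/4):ℝ)) := by rw [a1, a2]; simp
      _ = _ := by ring
  rw [e0]
  refine h1.trans ?_
  have hsq : ∀ (y : ENNReal) (p : ℝ), (y ^ p) ^ 2 = y ^ (p * 2) := by
    intro y p
    rw [ENNReal.rpow_mul, ENNReal.rpow_two]
  have e1 : ∀ t, (f t * (w t) ^ ((1:ℝ)/2) * V t ^ ((1:ℝ)/4)) ^ 2
      = w t * f t ^ 2 * V t ^ ((1:ℝ)/2) := by
    intro t
    rw [mul_pow, mul_pow, hsq, hsq]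
    norm_num
    ring
  have e2 : ∀ t, (((w t)⁻¹) ^ ((1:ℝ)/2) * (V t) ^ (-(1/4):ℝ)) ^ 2
      = (w t)⁻¹ * (V t) ^ (-(1/2):ℝ) := by
    intro t
    rw [mul_pow, hsq, hsq]
    norm_num
  simp only [e1, e2]
  gcongr
  exact hh_V (fun t => (w t)⁻¹) hw.inv a x

lemma hh_tonelli (g k : ℝ → ENNReal) (hg : Measurable g) (hk : Measurable k) (a : ℝ) (I : Set ℝ)
    (hI : MeasurableSet I) (hIa : ∀ x ∈ I, Ioo a x ⊆ I) (hIa' : ∀ x ∈ I, a < x) :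
    ∫⁻ x in I, k x * ∫⁻ t in Ioo a x, g t = ∫⁻ t in I, g t * ∫⁻ x in I ∩ Ioi t, k x := by
  have hms : MeasurableSet {p : ℝ × ℝ | p.2 < p.1} := measurableSet_lt measurable_snd measurable_fst
  have hmeas : Measurable (fun p : ℝ × ℝ =>
      {p : ℝ × ℝ | p.2 < p.1}.indicator (fun p => k p.1 * g p.2) p) :=
    ((hk.comp measurable_fst).mul (hg.comp measurable_snd)).indicator hms
  have h1 : ∫⁻ x in I, k x * ∫⁻ t in Ioo a x, g t = ∫⁻ x in I, ∫⁻ t in I,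
      {p : ℝ × ℝ | p.2 < p.1}.indicator (fun p => k p.1 * g p.2) (x, t) := by
    apply setLIntegral_congr_fun hI
    intro x hx
    have : Ioo a x = Iio x ∩ I := by
      ext t; exact ⟨fun h => ⟨h.2, hIa x hx h⟩, fun h => ⟨hIa' t h.2, h.1⟩⟩
    simp only
    rw [this, ← Measure.restrict_restrict measurableSet_Iio, ← lintegral_const_mul _ hg,
      ← lintegral_indicator measurableSet_Iio]
    rfl
  have h2 : ∫⁻ t in I, g t * ∫⁻ x in I ∩ Ioi t, k x = ∫⁻ t in I, ∫⁻ x in I,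
      {p : ℝ × ℝ | p.2 < p.1}.indicator (fun p => k p.1 * g p.2) (x, t) := by
    apply setLIntegral_congr_fun hI
    intro t ht
    simp only
    rw [inter_comm, ← Measure.restrict_restrict measurableSet_Ioi, ← lintegral_const_mul _ hk,
      ← lintegral_indicator measurableSet_Ioi]
    congr 1
    ext x
    by_cases h : t < x
    · simp [indicator, h, mul_comm]
    · simp [indicator, h]
  rw [h1, h2]
  exact lintegral_lintegral_swap hmeas.aemeasurable

lemma hh_upper (u w f : ℝ → ENNReal) (hu : Measurable u) (hw : Measurable w)
    (hwt : ∀ x, w x ≠ ⊤) (hf : Measurable f) (a : ℝ) (I : Set ℝ)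
    (hI : MeasurableSet I) (hIa : ∀ x ∈ I, Ioo a x ⊆ I) (hIa' : ∀ x ∈ I, a < x)
    (A : ENNReal) (hAt : A ≠ ⊤)
    (hA : ∀ c ∈ I, (∫⁻ s in I ∩ Ioi c, u s) ^ ((1 : ℝ)/2) *
        (∫⁻ t in Ioo a c, (w t)⁻¹) ^ ((1 : ℝ)/2) ≤ A) :
    ∫⁻ x in I, u x * (∫⁻ t in Ioo a x, f t) ^ 2 ≤ (2 * A) ^ 2 * ∫⁻ x in I, w x * f x ^ 2 := by
  set V : ℝ → ENNReal := fun t => ∫⁻ r in Ioo a t, (w r)⁻¹ with hVdef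
  have hVmono : Monotone V := fun s t h => lintegral_mono_set (Ioo_subset_Ioo_right h)
  have hVm := hVmono.measurable
  set U : ℝ → ENNReal := fun x => ∫⁻ s in I ∩ Ioi x, u s with hUdef
  have hUmono : Antitone U := fun s t h =>
    lintegral_mono_set (inter_subset_inter_right _ (Ioi_subset_Ioi h))
  have hUm := hUmono.measurable
  have hV0 : ∀ x ∈ I, V x ≠ 0 := fun x hx => hh_Vpos w hw hwt a x (hIa' x hx)
  set g : ℝ → ENNReal := fun t => w t * f t ^ 2 * V t ^ ((1:ℝ)/2) with hg
  have hgm : Measurable g := (hw.mul (hf.pow_const _)).mul (hVm.pow_const _)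
  set k : ℝ → ENNReal := fun x => u x * U x ^ (-(1/2):ℝ) with hk
  have hkm : Measurable k := hu.mul (hUm.pow_const _)
  have hpt : ∀ᵐ x ∂(volume.restrict I), u x * (∫⁻ t in Ioo a x, f t) ^ 2 ≤
      2 * A * (k x * ∫⁻ t in Ioo a x, g t) := by
    filter_upwards [hh_U0 u hu I, ae_restrict_mem hI] with x hx0 hxI
    by_cases hux : u x = 0
    · simp [hux]
    have hU0 : U x ≠ 0 := hx0 hux
    have hAx := hA x hxI
    have hVx : V x ≠ ⊤ := by
      intro h
      apply hAt
      rw [← top_le_iff]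
      refine le_trans (le_of_eq ?_) hAx
      change ⊤ = U x ^ ((1:ℝ)/2) * V x ^ ((1:ℝ)/2)
      rw [h, ENNReal.top_rpow_of_pos (by norm_num), ENNReal.mul_top]
      simp [ENNReal.rpow_eq_zero_iff, hU0]
    have hUx : U x ≠ ⊤ := by
      intro h
      apply hAt
      rw [← top_le_iff]
      refine le_trans (le_of_eq ?_) hAx
      change ⊤ = U x ^ ((1:ℝ)/2) * V x ^ ((1:ℝ)/2)
      rw [h, ENNReal.top_rpow_of_pos (by norm_num), ENNReal.top_mul]
      simp [ENNReal.rpow_eq_zero_iff, hV0 x hxI]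
    have hVle : V x ^ ((1:ℝ)/2) ≤ A * U x ^ (-(1/2):ℝ) := by
      have e : U x ^ ((1:ℝ)/2) * U x ^ (-(1/2):ℝ) = 1 := by
        rw [← ENNReal.rpow_add _ _ hU0 hUx]; norm_num
      calc V x ^ ((1:ℝ)/2) = (U x ^ ((1:ℝ)/2) * V x ^ ((1:ℝ)/2)) * U x ^ (-(1/2):ℝ) := by
            rw [mul_right_comm, e, one_mul]
        _ ≤ A * U x ^ (-(1/2):ℝ) := by gcongr
    have hs := hh_step w f hw hwt hf a x hVx
    calc u x * (∫⁻ t in Ioo a x, f t) ^ 2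
        ≤ u x * ((∫⁻ t in Ioo a x, g t) * (2 * V x ^ ((1:ℝ)/2))) := by gcongr
      _ ≤ u x * ((∫⁻ t in Ioo a x, g t) * (2 * (A * U x ^ (-(1/2):ℝ)))) := by gcongr
      _ = _ := by simp only [hk]; ring
  calc ∫⁻ x in I, u x * (∫⁻ t in Ioo a x, f t) ^ 2
      ≤ ∫⁻ x in I, 2 * A * (k x * ∫⁻ t in Ioo a x, g t) := lintegral_mono_ae hpt
    _ = 2 * A * ∫⁻ x in I, k x * ∫⁻ t in Ioo a x, g t :=
        lintegral_const_mul' _ _ (ENNReal.mul_ne_top (by simp) hAt)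
    _ = 2 * A * ∫⁻ t in I, g t * ∫⁻ x in I ∩ Ioi t, k x := by
        rw [hh_tonelli g k hgm hkm a I hI hIa hIa']
    _ ≤ 2 * A * ∫⁻ t in I, (2 * A) * (w t * f t ^ 2) := by
        gcongr 2 * A * ?_
        apply setLIntegral_mono' hI
        intro t ht
        calc g t * ∫⁻ x in I ∩ Ioi t, k x ≤ g t * (2 * U t ^ ((1:ℝ)/2)) := by
              gcongr; exact hh_U u hu I hI t
          _ = 2 * (U t ^ ((1:ℝ)/2) * V t ^ ((1:ℝ)/2)) * (w t * f t ^ 2) := by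
              simp only [hg]; ring
          _ ≤ 2 * A * (w t * f t ^ 2) := by gcongr; exact hA t ht
    _ = (2 * A) ^ 2 * ∫⁻ x in I, w x * f x ^ 2 := by
        rw [lintegral_const_mul' _ _ (ENNReal.mul_ne_top (by simp) hAt)]; ring

lemma hh_lower (u : ℝ → ENNReal) (v : ℝ → ℝ) (hu : Measurable u) (hv : Measurable v)
    (hv0 : ∀ x, 0 ≤ v x) (a : ℝ) (I : Set ℝ)
    (hI : MeasurableSet I) (hIa' : ∀ x ∈ I, a < x)
    (K : ENNReal)
    (h : ∀ f : ℝ → ℝ, Measurable f → (∀ x, 0 ≤ f x) →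
        ∫⁻ x in I, u x * (∫⁻ t in Ioo a x, ENNReal.ofReal (f t)) ^ 2 ≤
          K * ∫⁻ x in I, ENNReal.ofReal (v x) * ENNReal.ofReal (f x ^ 2))
    (c : ℝ) (hc : c ∈ I) :
    (∫⁻ s in I ∩ Ioi c, u s) * (∫⁻ t in Ioo a c, (ENNReal.ofReal (v t))⁻¹) ≤ K := by
  have hac := hIa' c hc
  have hstep : ∀ n : ℕ, (∫⁻ s in I ∩ Ioi c, u s) *
      (∫⁻ t in Ioo a c, ENNReal.ofReal ((v t + 1/((n:ℝ)+1))⁻¹)) ≤ K := by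
    intro n
    have hn : (0:ℝ) < 1/((n:ℝ)+1) := by positivity
    set e : ℝ := 1/((n:ℝ)+1) with he
    set J := ∫⁻ t in Ioo a c, ENNReal.ofReal ((v t + e)⁻¹) with hJ
    have hpos : ∀ t, 0 < (v t + e)⁻¹ := fun t => by have := hv0 t; positivity
    have hfm : Measurable fun t => (v t + e)⁻¹ := (hv.add_const e).inv
    have hJ0 : J ≠ 0 := by
      intro h0
      rw [hJ, lintegral_eq_zero_iff hfm.ennreal_ofReal] at h0
      have : ∀ᵐ x ∂(volume.restrict (Ioo a c)), False := by
        filter_upwards [h0] with x hx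
        have := ENNReal.ofReal_pos.2 (hpos x)
        exact this.ne' hx
      have hz := ae_iff.1 this
      simp at hz
      linarith
    have hJt : J ≠ ⊤ := by
      have : J ≤ ∫⁻ t in Ioo a c, ENNReal.ofReal e⁻¹ := by
        apply lintegral_mono
        intro t
        apply ENNReal.ofReal_le_ofReal
        exact inv_anti₀ hn (by linarith [hv0 t])
      refine ne_top_of_le_ne_top ?_ this
      rw [setLIntegral_const, Real.volume_Ioo]
      exact ENNReal.mul_ne_top ENNReal.ofReal_ne_top ENNReal.ofReal_ne_top
    have hf := h ((Ioo a c).indicator fun t => (v t + e)⁻¹) (hfm.indicator measurableSet_Ioo)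
      (fun x => indicator_nonneg (fun t _ => (hpos t).le) x)
    have hL : (∫⁻ s in I ∩ Ioi c, u s) * J ^ 2 ≤ ∫⁻ x in I, u x *
        (∫⁻ t in Ioo a x, ENNReal.ofReal ((Ioo a c).indicator (fun t => (v t + e)⁻¹) t)) ^ 2 := by
      rw [← lintegral_mul_const _ hu]
      refine le_trans ?_ (lintegral_mono_set (inter_subset_left (t := Ioi c)))
      apply setLIntegral_mono' (hI.inter measurableSet_Ioi)
      intro x hx
      gcongr
      refine le_trans (le_of_eq ?_) (lintegral_mono_set (Ioo_subset_Ioo_right (le_of_lt hx.2)))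
      apply setLIntegral_congr_fun measurableSet_Ioo
      intro t ht
      simp only [indicator_of_mem ht]
    have hR : ∫⁻ x in I, ENNReal.ofReal (v x) *
        ENNReal.ofReal ((Ioo a c).indicator (fun t => (v t + e)⁻¹) x ^ 2) ≤ J := by
      rw [hJ, ← lintegral_indicator measurableSet_Ioo]
      refine le_trans (setLIntegral_le_lintegral _ _) (lintegral_mono ?_)
      intro x
      by_cases hx : x ∈ Ioo a c
      · simp only [indicator_of_mem hx]
        rw [← ENNReal.ofReal_mul (hv0 x)]
        apply ENNReal.ofReal_le_ofReal
        have h1 := hpos x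
        have h2 : (v x + e) * (v x + e)⁻¹ = 1 := mul_inv_cancel₀ (by have := hv0 x; positivity)
        have h3 : v x * (v x + e)⁻¹ ≤ 1 := by nlinarith
        nlinarith
      · simp [indicator_of_notMem hx]
    have hfin : ((∫⁻ s in I ∩ Ioi c, u s) * J) * J ≤ K * J := by
      calc _ = (∫⁻ s in I ∩ Ioi c, u s) * J ^ 2 := by ring
        _ ≤ _ := hL.trans (hf.trans (by gcongr))
    exact (ENNReal.mul_le_mul_iff_left hJ0 hJt).1 hfin
  have hlim : ∫⁻ t in Ioo a c, (ENNReal.ofReal (v t))⁻¹ =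
      ⨆ n : ℕ, ∫⁻ t in Ioo a c, ENNReal.ofReal ((v t + 1/((n:ℝ)+1))⁻¹) := by
    rw [← lintegral_iSup (f := fun (n : ℕ) t => ENNReal.ofReal ((v t + 1/((n:ℝ)+1))⁻¹))
      (fun n => (hv.add_const _).inv.ennreal_ofReal)]
    · apply lintegral_congr
      intro t
      have hanti : Antitone fun n : ℕ => ENNReal.ofReal (v t + 1/((n:ℝ)+1)) := by
        intro m n hmn
        apply ENNReal.ofReal_le_ofReal
        have : 1/((n:ℝ)+1) ≤ 1/((m:ℝ)+1) := Nat.one_div_le_one_div hmn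
        linarith
      have ht : Tendsto (fun n : ℕ => ENNReal.ofReal (v t + 1/((n:ℝ)+1))) atTop
          (nhds (ENNReal.ofReal (v t))) := by
        apply ENNReal.tendsto_ofReal
        simpa using tendsto_one_div_add_atTop_nhds_zero_nat.const_add (v t)
      rw [← iInf_eq_of_tendsto hanti ht, ENNReal.inv_iInf]
      congr 1; ext n
      rw [ENNReal.ofReal_inv_of_pos]
      have := hv0 t; positivity
    · intro m n hmn t
      apply ENNReal.ofReal_le_ofReal
      have : 1/((n:ℝ)+1) ≤ 1/((m:ℝ)+1) := Nat.one_div_le_one_div hmn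
      have := hv0 t
      apply inv_anti₀ <;> first | positivity | linarith
  rw [hlim, ENNReal.mul_iSup]
  exact iSup_le hstep

/-- Muckenhoupt's two-weight Hardy inequality (`p = 2`): the inequality
`∫_a^b u(x)(∫_a^x f)² dx ≤ C² ∫_a^b v f²` holds for all `f ≥ 0` with some finite
`C` iff `A = sup_c (∫_c^b u)^{1/2}(∫_a^c v⁻¹)^{1/2} < ∞`; moreover every valid
constant satisfies `C ≥ A` and `C = 2A` is valid. -/
theorem stmt15 (a : ℝ) (I : Set ℝ)
    (hI : (∃ b : ℝ, a < b ∧ I = Ioo a b) ∨ I = Ioi a)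
    (u v : ℝ → ℝ) (hu : Measurable u) (hv : Measurable v)
    (hu0 : ∀ x, 0 ≤ u x) (hv0 : ∀ x, 0 ≤ v x)
    (A : ENNReal)
    (hA : A = ⨆ c ∈ I,
      (∫⁻ s in I ∩ Ioi c, ENNReal.ofReal (u s)) ^ ((1 : ℝ)/2) *
        (∫⁻ t in Ioo a c, (ENNReal.ofReal (v t))⁻¹) ^ ((1 : ℝ)/2)) :
    ((∃ C : ℝ, 0 < C ∧
        ∀ f : ℝ → ℝ, Measurable f → (∀ x, 0 ≤ f x) →
          ∫⁻ x in I, ENNReal.ofReal (u x) *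
              (∫⁻ t in Ioo a x, ENNReal.ofReal (f t)) ^ 2 ≤
            ENNReal.ofReal (C ^ 2) *
              ∫⁻ x in I, ENNReal.ofReal (v x) * ENNReal.ofReal (f x ^ 2)) ↔
      A ≠ ⊤) ∧
    (∀ C : ℝ, 0 < C →
      (∀ f : ℝ → ℝ, Measurable f → (∀ x, 0 ≤ f x) →
        ∫⁻ x in I, ENNReal.ofReal (u x) *
            (∫⁻ t in Ioo a x, ENNReal.ofReal (f t)) ^ 2 ≤
          ENNReal.ofReal (C ^ 2) *
            ∫⁻ x in I, ENNReal.ofReal (v x) * ENNReal.ofReal (f x ^ 2)) →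
      A ≤ ENNReal.ofReal C) ∧
    (A ≠ ⊤ →
      ∀ f : ℝ → ℝ, Measurable f → (∀ x, 0 ≤ f x) →
        ∫⁻ x in I, ENNReal.ofReal (u x) *
            (∫⁻ t in Ioo a x, ENNReal.ofReal (f t)) ^ 2 ≤
          (2 * A) ^ 2 *
            ∫⁻ x in I, ENNReal.ofReal (v x) * ENNReal.ofReal (f x ^ 2)) := by
  have hIm : MeasurableSet I := by
    rcases hI with ⟨b, _, rfl⟩ | rfl
    · exact measurableSet_Ioo
    · exact measurableSet_Ioi
  have hIa : ∀ x ∈ I, Ioo a x ⊆ I := by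
    rcases hI with ⟨b, _, rfl⟩ | rfl
    · exact fun x hx => Ioo_subset_Ioo_right hx.2.le
    · exact fun x hx t ht => ht.1
  have hIa' : ∀ x ∈ I, a < x := by
    rcases hI with ⟨b, _, rfl⟩ | rfl
    · exact fun x hx => hx.1
    · exact fun x hx => hx
  have hlow : ∀ C : ℝ, 0 < C →
      (∀ f : ℝ → ℝ, Measurable f → (∀ x, 0 ≤ f x) →
        ∫⁻ x in I, ENNReal.ofReal (u x) *
            (∫⁻ t in Ioo a x, ENNReal.ofReal (f t)) ^ 2 ≤
          ENNReal.ofReal (C ^ 2) *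
            ∫⁻ x in I, ENNReal.ofReal (v x) * ENNReal.ofReal (f x ^ 2)) →
      A ≤ ENNReal.ofReal C := by
    intro C hC h
    rw [hA]
    refine iSup₂_le fun c hc => ?_
    have h1 := hh_lower _ v hu.ennreal_ofReal hv hv0 a I hIm hIa' _ h c hc
    rw [← ENNReal.mul_rpow_of_nonneg _ _ (by norm_num)]
    refine (ENNReal.rpow_le_rpow h1 (by norm_num)).trans (le_of_eq ?_)
    rw [ENNReal.ofReal_pow hC.le, ← ENNReal.rpow_two, ← ENNReal.rpow_mul]
    norm_num
  have hupp : A ≠ ⊤ →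
      ∀ f : ℝ → ℝ, Measurable f → (∀ x, 0 ≤ f x) →
        ∫⁻ x in I, ENNReal.ofReal (u x) *
            (∫⁻ t in Ioo a x, ENNReal.ofReal (f t)) ^ 2 ≤
          (2 * A) ^ 2 *
            ∫⁻ x in I, ENNReal.ofReal (v x) * ENNReal.ofReal (f x ^ 2) := by
    intro hAt f hf hf0
    have h := hh_upper (fun x => ENNReal.ofReal (u x)) (fun x => ENNReal.ofReal (v x))
      (fun x => ENNReal.ofReal (f x)) hu.ennreal_ofReal hv.ennreal_ofReal
      (fun x => ENNReal.ofReal_ne_top) hf.ennreal_ofReal a I hIm hIa hIa' A hAt ?_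
    · simpa only [ENNReal.ofReal_pow (hf0 _)] using h
    · intro c hc
      rw [hA]
      exact le_iSup₂ (f := fun c (_ : c ∈ I) =>
        (∫⁻ s in I ∩ Ioi c, ENNReal.ofReal (u s)) ^ ((1 : ℝ)/2) *
        (∫⁻ t in Ioo a c, (ENNReal.ofReal (v t))⁻¹) ^ ((1 : ℝ)/2)) c hc
  refine ⟨⟨?_, ?_⟩, hlow, hupp⟩
  · rintro ⟨C, hC, h⟩
    exact ne_top_of_le_ne_top ENNReal.ofReal_ne_top (hlow C hC h)
  · intro hAt
    have hpos : 0 < 2 * A.toReal + 1 := by positivity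
    refine ⟨2 * A.toReal + 1, hpos, fun f hf hf0 => (hupp hAt f hf hf0).trans ?_⟩
    gcongr
    rw [ENNReal.ofReal_pow hpos.le]
    gcongr
    rw [ENNReal.ofReal_add (by positivity) (by norm_num), ENNReal.ofReal_mul (by norm_num),
      ENNReal.ofReal_toReal hAt]
    simp
end
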